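/- arXiv:gr-qc/0204030 — 2 statements merged into one kernel-verified Lean document; each statement's English description precedes it below -/
import Mathlib

section
/- In a collapsing ARS model, if R̃ : (0,r₁] → ℝ satisfies 0 ≤ R̃(r) ≤ r for all r and lim_{r→0⁺} ∫₀^{R̃(r)} H(r,σ) dσ = 0, then lim_{r→0⁺} R̃(r)/r = 0. -/
noncomputable section

open Real Set Filter Topology Asymptotics MeasureTheory intervalIntegral

/-- Data for an area-radius separable (ARS) spacetime: a size `r₀` of the comoving
coordinate range, generating functions `Ψ` (Misner–Sharp mass) and `Y`, the third-order
Taylor coefficients `h30, h21, h12, h03` of `G(r,R) = 2Ψ(r,R) + R(Y(r,R)² − 1)` at the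
origin, together with all the regularity and positivity requirements. -/
structure ARSData where
  r₀ : ℝ
  Ψ : ℝ → ℝ → ℝ
  Y : ℝ → ℝ → ℝ
  h30 : ℝ
  h21 : ℝ
  h12 : ℝ
  h03 : ℝ
  r₀_pos : 0 < r₀
  /-- `Ψ` and `Y` are `C^∞` on a neighborhood of `[0,r₀] × [0,r₀]`. -/
  smooth : ∃ U : Set (ℝ × ℝ), IsOpen U ∧ Icc 0 r₀ ×ˢ Icc 0 r₀ ⊆ U ∧
      ContDiffOn ℝ (⊤ : ℕ∞) (fun p : ℝ × ℝ => Ψ p.1 p.2) U ∧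
      ContDiffOn ℝ (⊤ : ℕ∞) (fun p : ℝ × ℝ => Y p.1 p.2) U
  Y_pos : ∀ r ∈ Icc (0:ℝ) r₀, ∀ R ∈ Icc (0:ℝ) r₀, 0 < Y r R
  Ψ_nonneg : ∀ r ∈ Icc (0:ℝ) r₀, ∀ R ∈ Icc (0:ℝ) r₀, 0 ≤ Ψ r R
  Ψr_nonneg : ∀ r ∈ Icc (0:ℝ) r₀, ∀ R ∈ Icc (0:ℝ) r₀, 0 ≤ deriv (fun s => Ψ s R) r
  ΨR_nonneg : ∀ r ∈ Icc (0:ℝ) r₀, ∀ R ∈ Icc (0:ℝ) r₀, 0 ≤ deriv (fun s => Ψ r s) R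
  Y_origin : Y 0 0 = 1
  Yr_origin : deriv (fun s => Y s 0) 0 = 0
  YR_origin : deriv (fun s => Y 0 s) 0 = 0
  Ψ_origin : Ψ 0 0 = 0
  Ψr_origin : deriv (fun s => Ψ s 0) 0 = 0
  ΨR_origin : deriv (fun s => Ψ 0 s) 0 = 0
  Ψrr_origin : deriv (deriv (fun s => Ψ s 0)) 0 = 0
  ΨrR_origin : deriv (fun s => deriv (fun t => Ψ s t) 0) 0 = 0
  ΨRR_origin : deriv (deriv (fun s => Ψ 0 s)) 0 = 0
  /-- Third-order Taylor expansion of `G(r,R) = 2Ψ + R(Y²−1)` at the origin. -/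
  taylor : (fun p : ℝ × ℝ =>
      (2 * Ψ p.1 p.2 + p.2 * ((Y p.1 p.2) ^ 2 - 1)) -
        (h30 * p.1 ^ 3 + h21 * p.1 ^ 2 * p.2 + h12 * p.1 * p.2 ^ 2 + h03 * p.2 ^ 3))
      =o[𝓝[Icc (0:ℝ) r₀ ×ˢ Icc (0:ℝ) r₀] (0, 0)] fun p : ℝ × ℝ => (p.1 + p.2) ^ 3
  /-- `α = h₃₀ > 0`. -/
  α_pos : 0 < h30
  /-- `P(τ) = Σ_{i+j=3} h_{ij} τ^j > 0` on `[0,1]`. -/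
  P_pos : ∀ τ ∈ Icc (0:ℝ) 1, 0 < h30 + h21 * τ + h12 * τ ^ 2 + h03 * τ ^ 3
  G_pos : ∀ r R : ℝ, 0 < R → R ≤ r → r ≤ r₀ →
      0 < 2 * Ψ r R + R * ((Y r R) ^ 2 - 1)

namespace ARSData

variable (a : ARSData)

/-- `G(r,R) := 2Ψ(r,R) + R(Y(r,R)² − 1)`. -/
def G (r R : ℝ) : ℝ := 2 * a.Ψ r R + R * ((a.Y r R) ^ 2 - 1)

/-- `H(r,R) := √(R/G(r,R))`. -/
def H (r R : ℝ) : ℝ := Real.sqrt (R / a.G r R)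

/-- `u(r,R) := √(G(r,R)/R)`. -/
def u (r R : ℝ) : ℝ := Real.sqrt (a.G r R / R)

/-- `√Δ(r,R) := ∫_R^r (1/Y(r,σ)) ∂H/∂r(r,σ) dσ + H(r,r)/Y(r,r)`. -/
def sqrtΔ (r R : ℝ) : ℝ :=
  (∫ σ in R..r, (a.Y r σ)⁻¹ * deriv (fun s => a.H s σ) r) + a.H r r / a.Y r r

/-- `P(τ) := Σ_{i+j=3} h_{ij} τ^j`. -/
def P (τ : ℝ) : ℝ := a.h30 + a.h21 * τ + a.h12 * τ ^ 2 + a.h03 * τ ^ 3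

end ARSData


namespace ARSData

/-- For `r` in the coordinate range, `G(r,·)` is continuous on the coordinate range. -/
lemma continuousOn_G (a : ARSData) {r : ℝ} (hr : r ∈ Icc (0:ℝ) a.r₀) :
    ContinuousOn (a.G r) (Icc 0 a.r₀) := by
  obtain ⟨U, -, hU, hΨ, hY⟩ := a.smooth
  have hmap : MapsTo (fun R : ℝ => (r, R)) (Icc 0 a.r₀) U := fun R hR => hU ⟨hr, hR⟩
  have hpair : ContinuousOn (fun R : ℝ => (r, R)) (Icc 0 a.r₀) := by fun_prop
  have hΨr : ContinuousOn (fun R => a.Ψ r R) (Icc 0 a.r₀) := hΨ.continuousOn.comp hpair hmap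
  have hYr : ContinuousOn (fun R => a.Y r R) (Icc 0 a.r₀) := hY.continuousOn.comp hpair hmap
  unfold G
  fun_prop

/-- Near the centre, `G` is positive on `0 ≤ R ≤ r` and is dominated by `r³` there. -/
lemma exists_G_bounds (a : ARSData) :
    ∃ C : ℝ, 1 ≤ C ∧ ∀ᶠ r in 𝓝[>] (0:ℝ), ∀ R ∈ Icc 0 r, 0 < a.G r R ∧ a.G r R ≤ C * r ^ 3 := by
  have hα := a.α_pos
  refine ⟨1 + |a.h30| + |a.h21| + |a.h12| + |a.h03| + 4 * a.h30, ?_, ?_⟩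
  · linarith [abs_nonneg a.h30, abs_nonneg a.h21, abs_nonneg a.h12, abs_nonneg a.h03]
  obtain ⟨δ, hδ, hball⟩ :=
    Metric.mem_nhdsWithin_iff.1 (a.taylor.def (c := a.h30 / 2) (by positivity))
  filter_upwards [Ioo_mem_nhdsGT (lt_min hδ a.r₀_pos)] with r hr R hR
  obtain ⟨hr0, hr⟩ := hr
  obtain ⟨hrδ, hrr₀⟩ := lt_min_iff.1 hr
  obtain ⟨hR0, hRr⟩ := hR
  have hmem : (r, R) ∈ Metric.ball ((0, 0) : ℝ × ℝ) δ ∩ Icc 0 a.r₀ ×ˢ Icc 0 a.r₀ := by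
    refine ⟨?_, ⟨hr0.le, hrr₀.le⟩, hR0, by linarith⟩
    rw [Metric.mem_ball, Prod.dist_eq, max_lt_iff, Real.dist_eq, Real.dist_eq, sub_zero, sub_zero,
      abs_of_pos hr0, abs_of_nonneg hR0]
    exact ⟨hrδ, by linarith⟩
  have happrox : |a.G r R - (a.h30 * r ^ 3 + a.h21 * r ^ 2 * R + a.h12 * r * R ^ 2
      + a.h03 * R ^ 3)| ≤ a.h30 / 2 * (r + R) ^ 3 := by
    have h := hball hmem
    simp only [mem_ofPred_eq, Real.norm_eq_abs] at h
    rwa [abs_of_nonneg (show 0 ≤ (r + R) ^ 3 by positivity)] at h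
  constructor
  · rcases hR0.eq_or_lt with rfl | hRpos
    · have := (abs_le.1 happrox).1
      have : 0 < a.h30 * r ^ 3 := by positivity
      simp only [add_zero, mul_zero, ne_eq, OfNat.ofNat_ne_zero, not_false_eq_true, zero_pow]
        at *
      linarith
    · exact a.G_pos r R hRpos hRr hrr₀.le
  · have hsum : (r + R) ^ 3 ≤ 8 * r ^ 3 := by
      calc (r + R) ^ 3 ≤ (r + r) ^ 3 := by gcongr
        _ = 8 * r ^ 3 := by ring
    have h30 : a.h30 * r ^ 3 ≤ |a.h30| * r ^ 3 := by gcongr; exact le_abs_self _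
    have h21 : a.h21 * r ^ 2 * R ≤ |a.h21| * r ^ 3 := by
      calc a.h21 * r ^ 2 * R ≤ |a.h21| * r ^ 2 * r := by gcongr; exact le_abs_self _
        _ = |a.h21| * r ^ 3 := by ring
    have h12 : a.h12 * r * R ^ 2 ≤ |a.h12| * r ^ 3 := by
      calc a.h12 * r * R ^ 2 ≤ |a.h12| * r * r ^ 2 := by gcongr; exact le_abs_self _
        _ = |a.h12| * r ^ 3 := by ring
    have h03 : a.h03 * R ^ 3 ≤ |a.h03| * r ^ 3 := by gcongr; exact le_abs_self _
    have herr : a.h30 / 2 * (r + R) ^ 3 ≤ 4 * a.h30 * r ^ 3 := by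
      calc a.h30 / 2 * (r + R) ^ 3 ≤ a.h30 / 2 * (8 * r ^ 3) := by gcongr
        _ = 4 * a.h30 * r ^ 3 := by ring
    have := (abs_le.1 happrox).2
    have : 0 < r ^ 3 := by positivity
    linarith

/-- If `0 < G(r,·) ≤ C r³` on `[0,r]`, then `∫₀^ρ H(r,σ) dσ` controls `(ρ/r)²`. -/
lemma sq_div_le_integral_H (a : ARSData) {C r ρ : ℝ} (hC : 1 ≤ C) (hr : r ∈ Ioc (0:ℝ) a.r₀)
    (hG : ∀ R ∈ Icc 0 r, 0 < a.G r R ∧ a.G r R ≤ C * r ^ 3) (hρ : ρ ∈ Icc 0 r) :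
    (ρ / r) ^ 2 ≤ 2 * C * ∫ σ in (0:ℝ)..ρ, a.H r σ := by
  obtain ⟨hr0, hrr₀⟩ := hr
  obtain ⟨hρ0, hρr⟩ := hρ
  have hC0 : 0 < C := by linarith
  have hHcont : ContinuousOn (a.H r) (Icc 0 ρ) := by
    have hGcont := (a.continuousOn_G ⟨hr0.le, hrr₀⟩).mono (Icc_subset_Icc_right (hρr.trans hrr₀))
    exact (continuousOn_id.div hGcont fun R hR => (hG R ⟨hR.1, hR.2.trans hρr⟩).1.ne').sqrt
  have hlower : ∀ σ ∈ Icc 0 ρ, (C * r ^ 2)⁻¹ * σ ≤ a.H r σ := by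
    rintro σ ⟨hσ0, hσρ⟩
    have hσr := hσρ.trans hρr
    obtain ⟨hGpos, hGle⟩ := hG σ ⟨hσ0, hσr⟩
    apply Real.le_sqrt_of_sq_le
    rw [le_div_iff₀ hGpos]
    calc ((C * r ^ 2)⁻¹ * σ) ^ 2 * a.G r σ
        ≤ ((C * r ^ 2)⁻¹ * σ) ^ 2 * (C * r ^ 3) := by gcongr
      _ = σ * ((σ / r) * C⁻¹) := by field_simp
      _ ≤ σ * (1 * 1) := by
        gcongr
        · exact (div_le_one hr0).2 hσr
        · exact inv_le_one_of_one_le₀ hC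
      _ = σ := by ring
  have hint : ∫ σ in (0:ℝ)..ρ, (C * r ^ 2)⁻¹ * σ ≤ ∫ σ in (0:ℝ)..ρ, a.H r σ :=
    intervalIntegral.integral_mono_on hρ0 (Continuous.intervalIntegrable (by fun_prop) _ _)
      (hHcont.intervalIntegrable_of_Icc hρ0) hlower
  rw [intervalIntegral.integral_const_mul, integral_id] at hint
  calc (ρ / r) ^ 2 = 2 * C * ((C * r ^ 2)⁻¹ * ((ρ ^ 2 - 0 ^ 2) / 2)) := by field_simp; ring
    _ ≤ _ := by gcongr

end ARSData

/-- **Lemma (curves reaching the singularity at the singular time are sub-linear).**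
In a collapsing ARS model, if `0 ≤ R̃(r) ≤ r` on `(0, r₁]` and
`∫₀^{R̃(r)} H(r,σ) dσ → 0` as `r → 0⁺`, then `R̃(r)/r → 0` as `r → 0⁺`. -/
theorem tendsto_ratio_zero_of_time_integral_vanishes (a : ARSData)
    (r₁ : ℝ) (hr₁ : r₁ ∈ Ioc (0:ℝ) a.r₀) (Rt : ℝ → ℝ)
    (hRt : ∀ r ∈ Ioc (0:ℝ) r₁, 0 ≤ Rt r ∧ Rt r ≤ r)
    (hlim : Tendsto (fun r => ∫ σ in (0:ℝ)..(Rt r), a.H r σ) (𝓝[>] 0) (𝓝 0)) :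
    Tendsto (fun r => Rt r / r) (𝓝[>] 0) (𝓝 0) := by
  obtain ⟨C, hC, hG⟩ := a.exists_G_bounds
  have hsq : Tendsto (fun r => (Rt r / r) ^ 2) (𝓝[>] 0) (𝓝 0) := by
    refine tendsto_of_tendsto_of_tendsto_of_le_of_le' tendsto_const_nhds
      (by simpa using hlim.const_mul (2 * C)) (.of_forall fun r => sq_nonneg _) ?_
    filter_upwards [hG, Ioc_mem_nhdsGT hr₁.1] with r hGr hr
    exact a.sq_div_le_integral_H hC ⟨hr.1, hr.2.trans hr₁.2⟩ hGr (hRt r hr)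
  have habs := hsq.sqrt
  simp only [Real.sqrt_sq_eq_abs, Real.sqrt_zero] at habs
  exact (tendsto_zero_iff_abs_tendsto_zero _).2 habs
end
end

section
/- In a collapsing ARS model, any singularity which is radially censored is censored: let A(r,R) := Δ(r,R)(1 − 2Ψ(r,R)/R) and, for L > 0, consider the non-radial null geodesic equation dR/dr = u(r,R) Y(r,R) √Δ(r,R) − u(r,R)² √(Δ(r,R) + L²/(u(r,R)² R²)) (whose L = 0 case is the radial null geodesic equation). If the central singularity is covered (no radial null geodesic escapes), then for every L > 0 there is no solution R̃ of the non-radial null geodesic equation on any interval (0,r₁] with R_h(r) < R̃(r) < r for all r, lim_{r→0⁺} R̃(r) = 0 and lim_{r→0⁺} ∫₀^{R̃(r)} H(r,σ) dσ = 0. -/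
noncomputable section

open Real Set Filter Topology Asymptotics MeasureTheory intervalIntegral

/-- The critical value `ξ_c = (26 + 15√3)/2`. -/
def ξc : ℝ := (26 + 15 * Real.sqrt 3) / 2

/-- A collapsing ARS model: an ARS spacetime with no shell-crossing singularities
(`√Δ > 0`), the asymptotic expansion `√Δ(r,0) = ξ r^{n−1} + o(r^{n−1})`, and an
apparent horizon `R_h`. -/
structure CollapsingARS extends ARSData where
  ξ : ℝ
  n : ℕ
  Rh : ℝ → ℝ
  ξ_pos : 0 < ξ
  n_pos : 1 ≤ n
  sqrtΔ_pos : ∀ r ∈ Ioc (0:ℝ) r₀, ∀ R ∈ Icc (0:ℝ) r, 0 < toARSData.sqrtΔ r R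
  sqrtΔ_asym : (fun r : ℝ => toARSData.sqrtΔ r 0 - ξ * r ^ (n - 1))
      =o[𝓝[>] (0:ℝ)] fun r : ℝ => r ^ (n - 1)
  Rh_pos : ∀ r ∈ Ioc (0:ℝ) r₀, 0 < Rh r
  Rh_lt : ∀ r ∈ Ioc (0:ℝ) r₀, Rh r < r
  Rh_eq : ∀ r ∈ Ioc (0:ℝ) r₀, Rh r = 2 * Ψ r (Rh r)

namespace CollapsingARS

variable (c : CollapsingARS)

/-- The central singularity is locally naked: some radial null geodesic `R_g`
escapes from the apparent horizon back to the central singularity. -/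
def LocallyNaked : Prop :=
  ∃ r₁ ∈ Ioc (0:ℝ) c.r₀, ∃ Rg : ℝ → ℝ,
    (∀ r ∈ Ioc (0:ℝ) r₁, HasDerivAt Rg
      (c.u r (Rg r) * c.sqrtΔ r (Rg r) * (c.Y r (Rg r) - c.u r (Rg r))) r) ∧
    (∀ r ∈ Ioc (0:ℝ) r₁, c.Rh r < Rg r ∧ Rg r < r) ∧
    Tendsto Rg (𝓝[>] 0) (𝓝 0) ∧
    Tendsto (fun r => ∫ σ in (0:ℝ)..(Rg r), c.H r σ) (𝓝[>] 0) (𝓝 0)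

end CollapsingARS

/-- A backward barrier principle: if `f b ≤ B b` and `f` grows strictly faster than `B` at every
contact point, then `f ≤ B` on `[a, b]`. -/
theorem image_le_of_deriv_left_lt_deriv_boundary {f f' B B' : ℝ → ℝ} {a b : ℝ}
    (hf : ∀ x ∈ Icc a b, HasDerivWithinAt f (f' x) (Icc a b) x)
    (hB : ∀ x ∈ Icc a b, HasDerivWithinAt B (B' x) (Icc a b) x)
    (hb : f b ≤ B b) (bound : ∀ x ∈ Icc a b, f x = B x → B' x < f' x) :
    ∀ x ∈ Icc a b, f x ≤ B x := by
  have reflect : ∀ {g g' : ℝ → ℝ}, (∀ x ∈ Icc a b, HasDerivWithinAt g (g' x) (Icc a b) x) →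
      ∀ x ∈ Icc (-b) (-a),
        HasDerivWithinAt (fun t => g (-t)) (-g' (-x)) (Icc (-b) (-a)) x := by
    intro g g' hg x hx
    have hmaps : MapsTo (fun t : ℝ => -t) (Icc (-b) (-a)) (Icc a b) := fun t ht =>
      ⟨le_neg_of_le_neg ht.2, neg_le_of_neg_le ht.1⟩
    have := (hg (-x) (hmaps hx)).scomp x (hasDerivAt_neg x).hasDerivWithinAt hmaps
    rw [neg_smul, one_smul] at this
    exact this
  have right : ∀ {g g' : ℝ → ℝ}, (∀ x ∈ Icc (-b) (-a),
      HasDerivWithinAt g (g' x) (Icc (-b) (-a)) x) →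
      ∀ x ∈ Ico (-b) (-a), HasDerivWithinAt g (g' x) (Ici x) x := fun hg x hx =>
    (hg x ⟨hx.1, hx.2.le⟩).mono_of_mem_nhdsWithin (Icc_mem_nhdsGE_of_mem hx)
  intro x hx
  have key := image_le_of_deriv_right_lt_deriv_boundary'
    (fun y hy => (reflect hf y hy).continuousWithinAt) (right (reflect hf))
    (by simpa using hb)
    (fun y hy => (reflect hB y hy).continuousWithinAt) (right (reflect hB))
    (fun y hy hy' => neg_lt_neg <|
      bound (-y) ⟨le_neg_of_le_neg hy.2.le, neg_le_of_neg_le hy.1⟩ hy')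
    (x := -x) ⟨neg_le_neg hx.2, neg_le_neg hx.1⟩
  simpa using key

/-- A backward solution of `y' = f(r, y)` trapped between the constant strict lower barrier `δ` and
the strict upper barrier `S`. -/
theorem exists_solution_between_barriers {f : ℝ → ℝ → ℝ} {S S' : ℝ → ℝ} {ε ρ δ : ℝ} {K : NNReal}
    (hερ : ε ≤ ρ)
    (hfc : ContinuousOn (Function.uncurry f) {p | p.1 ∈ Icc ε ρ ∧ p.2 ∈ Icc δ (S p.1)})
    (hfl : ∀ r ∈ Icc ε ρ, LipschitzOnWith K (f r) (Icc δ (S r)))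
    (hS : ∀ r ∈ Icc ε ρ, HasDerivWithinAt S (S' r) (Icc ε ρ) r)
    (hS' : ∀ r ∈ Icc ε ρ, S' r < f r (S r))
    (hδS : ∀ r ∈ Icc ε ρ, δ < S r) (hfδ : ∀ r ∈ Icc ε ρ, f r δ < 0) :
    ∃ y : ℝ → ℝ, y ρ = S ρ ∧ ∀ r ∈ Icc ε ρ,
      HasDerivWithinAt y (f r (y r)) (Icc ε ρ) r ∧ y r ∈ Icc δ (S r) := by
  let cl : ℝ → ℝ → ℝ := fun r x => max δ (min x (S r))
  let F : ℝ → ℝ → ℝ := fun r x => f r (cl r x)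
  have hScont : ContinuousOn S (Icc ε ρ) := fun r hr => (hS r hr).continuousWithinAt
  have hcl : ∀ r ∈ Icc ε ρ, ∀ x, cl r x ∈ Icc δ (S r) := fun r hr x =>
    ⟨le_max_left _ _, max_le (hδS r hr).le (min_le_right _ _)⟩
  have hcompact : IsCompact {p : ℝ × ℝ | p.1 ∈ Icc ε ρ ∧ p.2 ∈ Icc δ (S p.1)} := by
    have himage : {p : ℝ × ℝ | p.1 ∈ Icc ε ρ ∧ p.2 ∈ Icc δ (S p.1)} =
        (fun q : ℝ × ℝ => (q.1, δ + q.2 * (S q.1 - δ))) '' (Icc ε ρ ×ˢ Icc 0 1) := by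
      ext ⟨r, x⟩
      constructor
      · rintro ⟨hr, hx⟩
        have hpos : 0 < S r - δ := sub_pos.2 (hδS r hr)
        refine ⟨(r, (x - δ) / (S r - δ)), ⟨hr, div_nonneg (sub_nonneg.2 hx.1) hpos.le,
          (div_le_one hpos).2 (sub_le_sub_right hx.2 _)⟩, ?_⟩
        simp [div_mul_cancel₀ _ hpos.ne']
      · rintro ⟨⟨r', t⟩, ⟨hr, ht⟩, heq⟩
        obtain ⟨rfl, rfl⟩ := Prod.mk.inj heq
        have hpos : 0 < S r' - δ := sub_pos.2 (hδS r' hr)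
        have ht0 : 0 ≤ t := ht.1
        have ht1 : t ≤ 1 := ht.2
        exact ⟨hr, by nlinarith, by nlinarith⟩
    rw [himage]
    refine (isCompact_Icc.prod isCompact_Icc).image_of_continuousOn ?_
    have : ContinuousOn (fun q : ℝ × ℝ => S q.1) (Icc ε ρ ×ˢ Icc 0 1) :=
      hScont.comp continuousOn_fst fun q hq => hq.1
    exact continuousOn_fst.prodMk
      (continuousOn_const.add (continuousOn_snd.mul (this.sub continuousOn_const)))
  obtain ⟨M, hM⟩ := hcompact.exists_bound_of_continuousOn hfc
  have hF : IsPicardLindelof F (⟨ρ, right_mem_Icc.2 hερ⟩ : Icc ε ρ) (S ρ)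
      (Real.toNNReal (M.toNNReal * (ρ - ε))) 0 M.toNNReal K := by
    constructor
    · intro r hr x _ x' _
      refine (hfl r hr (hcl r hr x) (hcl r hr x')).trans ?_
      gcongr
      rw [edist_dist, edist_dist]
      refine ENNReal.ofReal_le_ofReal ?_
      rw [Real.dist_eq, Real.dist_eq]
      exact (abs_max_sub_max_le_max _ _ _ _).trans
        (by simpa using abs_min_sub_min_le_max x (S r) x' (S r))
    · intro x _
      refine hfc.comp (f := fun r => (r, cl r x)) ?_ fun r hr => ⟨hr, hcl r hr x⟩
      exact continuousOn_id.prodMk (continuousOn_const.sup (continuousOn_const.inf hScont))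
    · intro r hr x _
      exact (hM (r, cl r x) ⟨hr, hcl r hr x⟩).trans (le_coe_toNNReal M)
    · simp [sub_nonneg.2 hερ]
  obtain ⟨y, hy₀, hy⟩ := hF.exists_eq_forall_mem_Icc_hasDerivWithinAt₀
  have hupper : ∀ r ∈ Icc ε ρ, y r ≤ S r :=
    image_le_of_deriv_left_lt_deriv_boundary hy hS hy₀.le fun r hr hr' => by
      simpa [F, cl, hr', (hδS r hr).le] using hS' r hr
  have hlower : ∀ r ∈ Icc ε ρ, δ ≤ y r :=
    image_le_of_deriv_left_lt_deriv_boundary (f := fun _ => δ) (f' := fun _ => 0)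
      (fun r _ => hasDerivWithinAt_const _ _ _) hy
      ((hδS ρ (right_mem_Icc.2 hερ)).le.trans hy₀.ge) fun r hr hr' => by
      simpa [F, cl, ← hr', (hδS r hr).le] using hfδ r hr
  refine ⟨y, hy₀, fun r hr => ⟨?_, hlower r hr, hupper r hr⟩⟩
  simpa [F, cl, hlower r hr, hupper r hr] using hy r hr

/-- A backward solution of `y' = f(r, y)` on all of `(0, ρ]` below the strict upper barrier `S`,
provided that there are strict constant lower barriers on each `[ε, ρ]`. -/
theorem exists_solution_below_barrier {f : ℝ → ℝ → ℝ} {S S' : ℝ → ℝ} {ρ : ℝ} (hρ : 0 < ρ)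
    (hfc : ∀ δ > 0, ContinuousOn (Function.uncurry f) {p | δ ≤ p.2 ∧ p.2 ≤ p.1 ∧ p.1 ≤ ρ})
    (hfl : ∀ δ > 0, ∃ K : NNReal, ∀ r ≤ ρ, LipschitzOnWith K (f r) (Icc δ r))
    (hS : ∀ r ∈ Ioc 0 ρ, HasDerivAt S (S' r) r)
    (hS' : ∀ r ∈ Ioc 0 ρ, S' r < f r (S r)) (hSr : ∀ r ∈ Ioc 0 ρ, S r < r)
    (hlow : ∀ ε ∈ Ioc 0 ρ, ∃ δ > 0, ∀ r ∈ Icc ε ρ, δ < S r ∧ f r δ < 0) :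
    ∃ y : ℝ → ℝ, y ρ = S ρ ∧ ∀ r ∈ Ioc 0 ρ,
      HasDerivWithinAt y (f r (y r)) (Ioc 0 ρ) r ∧ 0 < y r ∧ y r ≤ S r := by
  have hsub : ∀ ε ∈ Ioc 0 ρ, Icc ε ρ ⊆ Ioc 0 ρ := fun ε hε r hr => ⟨hε.1.trans_le hr.1, hr.2⟩
  have hex : ∀ ε : ℝ, ∃ y : ℝ → ℝ, ∃ δ > 0, ε ∈ Ioc 0 ρ → y ρ = S ρ ∧ ∀ r ∈ Icc ε ρ,
      HasDerivWithinAt y (f r (y r)) (Icc ε ρ) r ∧ y r ∈ Icc δ (S r) := by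
    intro ε
    by_cases hε : ε ∈ Ioc 0 ρ
    swap
    · exact ⟨0, 1, one_pos, fun h => absurd h hε⟩
    obtain ⟨δ, hδ, hlow⟩ := hlow ε hε
    obtain ⟨K, hK⟩ := hfl δ hδ
    obtain ⟨y, hy⟩ := exists_solution_between_barriers hε.2
      ((hfc δ hδ).mono fun p hp => ⟨hp.2.1, hp.2.2.trans (hSr _ (hsub ε hε hp.1)).le, hp.1.2⟩)
      (fun r hr => (hK r hr.2).mono (Icc_subset_Icc_right (hSr r (hsub ε hε hr)).le))
      (fun r hr => (hS r (hsub ε hε hr)).hasDerivWithinAt)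
      (fun r hr => hS' r (hsub ε hε hr)) (fun r hr => (hlow r hr).1) fun r hr => (hlow r hr).2
    exact ⟨y, δ, hδ, fun _ => hy⟩
  choose y δ hδ hy using hex
  have huniq : ∀ ε ∈ Ioc 0 ρ, ∀ ε' ∈ Ioc 0 ρ, ε ≤ ε' → EqOn (y ε) (y ε') (Icc ε' ρ) := by
    intro ε hε ε' hε' hle
    obtain ⟨K, hK⟩ := hfl (min (δ ε) (δ ε')) (lt_min (hδ _) (hδ _))
    obtain ⟨h₀, h⟩ := hy ε hε
    obtain ⟨h₀', h'⟩ := hy ε' hε'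
    have hIcc : Icc ε' ρ ⊆ Icc ε ρ := Icc_subset_Icc_left hle
    refine ODE_solution_unique_of_mem_Icc_left (v := f) (K := K)
      (s := fun r => Icc (min (δ ε) (δ ε')) r) (fun r hr => hK r hr.2)
      (fun r hr => ((h r (hIcc hr)).1.mono hIcc).continuousWithinAt)
      (fun r hr => ?_) (fun r hr => ?_)
      (fun r hr => (h' r hr).1.continuousWithinAt)
      (fun r hr => ?_) (fun r hr => ?_) (h₀.trans h₀'.symm)
    · exact ((h r (hIcc (Ioc_subset_Icc_self hr))).1.mono hIcc).mono_of_mem_nhdsWithin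
        (Icc_mem_nhdsLE_of_mem hr)
    · have := (h r (hIcc (Ioc_subset_Icc_self hr))).2
      exact ⟨(min_le_left _ _).trans this.1,
        this.2.trans (hSr r (hsub ε' hε' (Ioc_subset_Icc_self hr))).le⟩
    · exact (h' r (Ioc_subset_Icc_self hr)).1.mono_of_mem_nhdsWithin (Icc_mem_nhdsLE_of_mem hr)
    · have := (h' r (Ioc_subset_Icc_self hr)).2
      exact ⟨(min_le_right _ _).trans this.1,
        this.2.trans (hSr r (hsub ε' hε' (Ioc_subset_Icc_self hr))).le⟩
  refine ⟨fun r => y (r / 2) r, (hy (ρ / 2) ⟨half_pos hρ, half_le_self hρ.le⟩).1, fun r hr => ?_⟩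
  have hr0 : 0 < r := hr.1
  have hrρ : r ≤ ρ := hr.2
  have hq : r / 4 ∈ Ioc 0 ρ := ⟨by linarith, by linarith⟩
  have heq : ∀ t ∈ Icc (r / 2) ρ, y (t / 2) t = y (r / 4) t := by
    intro t ht
    have ht1 : r / 2 ≤ t := ht.1
    have ht2 : t ≤ ρ := ht.2
    exact (huniq (r / 4) hq (t / 2) ⟨by linarith, by linarith⟩ (by linarith)
      ⟨by linarith, ht2⟩).symm
  have hrr : r ∈ Icc (r / 2) ρ := ⟨by linarith, hrρ⟩
  obtain ⟨hd, hb⟩ := (hy (r / 4) hq).2 r ⟨by linarith, hrρ⟩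
  have hmem : Icc (r / 2) ρ ∈ 𝓝[Ioc 0 ρ] r := by
    filter_upwards [self_mem_nhdsWithin,
      mem_nhdsWithin_of_mem_nhds (Ioi_mem_nhds (half_lt_self hr0))] with t ht ht'
    exact ⟨le_of_lt ht', ht.2⟩
  dsimp only
  rw [heq r hrr]
  refine ⟨?_, (hδ _).trans_le hb.1, hb.2⟩
  exact ((hd.mono (Icc_subset_Icc_left (by linarith))).mono_of_mem_nhdsWithin
    hmem).congr_of_eventuallyEq (by filter_upwards [hmem] with t ht using heq t ht) (heq r hrr)

namespace ARSData

variable (a : ARSData)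

/-- The right-hand side of the radial null geodesic equation. -/
def radialSlope (r R : ℝ) : ℝ := a.u r R * a.sqrtΔ r R * (a.Y r R - a.u r R)

variable {a}

theorem mul_sub_u_mul_add_u {r R : ℝ} (hR : 0 < R) (hRr : R ≤ r) (hr : r ≤ a.r₀) :
    (a.Y r R - a.u r R) * (a.Y r R + a.u r R) * R = R - 2 * a.Ψ r R := by
  have hu : a.u r R ^ 2 = a.G r R / R := Real.sq_sqrt (div_pos (a.G_pos r R hR hRr hr) hR).le
  have : (a.Y r R - a.u r R) * (a.Y r R + a.u r R) * R = (a.Y r R ^ 2 - a.u r R ^ 2) * R := by ring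
  rw [this, hu, sub_mul, div_mul_cancel₀ _ hR.ne', G]
  ring

theorem u_pos {r R : ℝ} (hR : 0 < R) (hRr : R ≤ r) (hr : r ≤ a.r₀) : 0 < a.u r R :=
  Real.sqrt_pos.2 (div_pos (a.G_pos r R hR hRr hr) hR)

theorem continuousOn_uncurry_G :
    ContinuousOn (Function.uncurry a.G) (Icc 0 a.r₀ ×ˢ Icc 0 a.r₀) := by
  obtain ⟨U, -, hU, hΨ, hY⟩ := a.smooth
  have hΨ := hΨ.continuousOn.mono hU
  have hY := hY.continuousOn.mono hU
  exact (continuousOn_const.mul hΨ).add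
    (continuousOn_snd.mul ((hY.pow 2).sub continuousOn_const))

variable (a) in
/-- Near the region `0 < R ≤ r ≤ r₀` the functions `Y`, `u` and `H` are smooth. -/
theorem exists_isOpen_contDiffOn : ∃ W : Set (ℝ × ℝ), IsOpen W ∧
    (∀ r R : ℝ, 0 < R → R ≤ r → r ≤ a.r₀ → (r, R) ∈ W) ∧ (∀ p ∈ W, 0 < a.Y p.1 p.2) ∧
    ContDiffOn ℝ (⊤ : ℕ∞) (Function.uncurry a.Y) W ∧
    ContDiffOn ℝ (⊤ : ℕ∞) (Function.uncurry a.u) W ∧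
    ContDiffOn ℝ (⊤ : ℕ∞) (Function.uncurry a.H) W := by
  obtain ⟨U, hUo, hU, hΨ, hY⟩ := a.smooth
  have hG : ContDiffOn ℝ (⊤ : ℕ∞) (Function.uncurry a.G) U :=
    (contDiffOn_const.mul hΨ).add (contDiffOn_snd.mul ((hY.pow 2).sub contDiffOn_const))
  let T : ℝ × ℝ → ℝ × ℝ × ℝ := fun p => (p.2, a.Y p.1 p.2, a.G p.1 p.2)
  have hT : ContinuousOn T U := continuousOn_snd.prodMk (hY.continuousOn.prodMk hG.continuousOn)
  refine ⟨U ∩ T ⁻¹' (Ioi 0 ×ˢ Ioi 0 ×ˢ Ioi 0),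
    hT.isOpen_inter_preimage hUo (isOpen_Ioi.prod (isOpen_Ioi.prod isOpen_Ioi)), ?_,
    fun p hp => hp.2.2.1, hY.mono inter_subset_left, ?_, ?_⟩
  · intro r R hR hRr hr
    have hr' : r ∈ Icc 0 a.r₀ := ⟨hR.le.trans hRr, hr⟩
    have hR' : R ∈ Icc 0 a.r₀ := ⟨hR.le, hRr.trans hr⟩
    exact ⟨hU ⟨hr', hR'⟩, hR, a.Y_pos r hr' R hR', a.G_pos r R hR hRr hr⟩
  · exact ((hG.mono inter_subset_left).div contDiffOn_snd fun p hp => ne_of_gt hp.2.1).sqrt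
      fun p hp => (div_pos hp.2.2.2 hp.2.1).ne'
  · exact (contDiffOn_snd.div (hG.mono inter_subset_left) fun p hp => ne_of_gt hp.2.2.2).sqrt
      fun p hp => (div_pos hp.2.1 hp.2.2.2).ne'

theorem isCompact_triangle (δ ρ : ℝ) :
    IsCompact {p : ℝ × ℝ | δ ≤ p.2 ∧ p.2 ≤ p.1 ∧ p.1 ≤ ρ} := by
  refine (isCompact_Icc.prod isCompact_Icc).of_isClosed_subset (s := Icc δ ρ ×ˢ Icc δ ρ) ?_
    fun p hp => ⟨⟨hp.1.trans hp.2.1, hp.2.2⟩, ⟨hp.1, hp.2.1.trans hp.2.2⟩⟩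
  exact (isClosed_le continuous_const continuous_snd).inter
    ((isClosed_le continuous_snd continuous_fst).inter
      (isClosed_le continuous_fst continuous_const))

theorem convex_triangle (δ ρ : ℝ) :
    Convex ℝ {p : ℝ × ℝ | δ ≤ p.2 ∧ p.2 ≤ p.1 ∧ p.1 ≤ ρ} := by
  rintro ⟨r, R⟩ ⟨h1, h2, h3⟩ ⟨r', R'⟩ ⟨h1', h2', h3'⟩ s t hs ht hst
  dsimp only at *
  obtain rfl : t = 1 - s := by linarith
  refine ⟨?_, ?_, ?_⟩ <;> simp only [Prod.smul_mk, Prod.mk_add_mk, smul_eq_mul] <;> nlinarith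

/-- On `δ ≤ R ≤ r ≤ ρ` the function `√Δ` is continuous, and Lipschitz in `R` uniformly in `r`. -/
theorem sqrtΔ_regular {δ ρ : ℝ} (hδ : 0 < δ) (hρ : ρ ≤ a.r₀) :
    ContinuousOn (Function.uncurry a.sqrtΔ) {p | δ ≤ p.2 ∧ p.2 ≤ p.1 ∧ p.1 ≤ ρ} ∧
    ∃ C : ℝ, ∀ r ≤ ρ, ∀ R ∈ Icc δ r, ∀ R' ∈ Icc δ r,
      |a.sqrtΔ r R - a.sqrtΔ r R'| ≤ C * |R - R'| := by
  obtain ⟨W, hWo, hW, hYpos, hY, -, hH⟩ := a.exists_isOpen_contDiffOn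
  rcases lt_or_ge ρ δ with hρδ | hδρ
  · refine ⟨fun p hp => absurd (hp.1.trans (hp.2.1.trans hp.2.2)) hρδ.not_ge, 0, ?_⟩
    intro r hr R hR
    exact absurd (hR.1.trans (hR.2.trans hr)) hρδ.not_ge
  let T : Set (ℝ × ℝ) := {p | δ ≤ p.2 ∧ p.2 ≤ p.1 ∧ p.1 ≤ ρ}
  have hTW : T ⊆ W := fun p hp => hW p.1 p.2 (hδ.trans_le hp.1) hp.2.1 (hp.2.2.trans hρ)
  let q : ℝ × ℝ → ℝ := fun p => (a.Y p.1 p.2)⁻¹ * deriv (fun s => a.H s p.2) p.1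
  have hq : ContinuousOn q W := by
    refine (hY.continuousOn.inv₀ fun p hp => (hYpos p hp).ne').mul ?_
    refine ((hH.continuousOn_fderiv_of_isOpen hWo (by simp)).clm_apply
      (continuousOn_const (c := ((1, 0) : ℝ × ℝ)))).congr fun p hp => ?_
    have hd := ((hH.contDiffAt (hWo.mem_nhds hp)).differentiableAt (by simp)).hasFDerivAt
    exact (hd.comp_hasDerivAt p.1 ((hasDerivAt_id p.1).prodMk (hasDerivAt_const p.1 p.2))).deriv
  let cl : ℝ × ℝ → ℝ × ℝ := fun p =>
    (max δ (min p.1 ρ), max δ (min p.2 (max δ (min p.1 ρ))))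
  have hcl : ∀ p, cl p ∈ T := fun p => ⟨le_max_left _ _,
    max_le (le_max_left _ _) (min_le_right _ _), max_le hδρ (min_le_right _ _)⟩
  have hcl_id : ∀ p ∈ T, cl p = p := fun p hp => by
    have h1 : max δ (min p.1 ρ) = p.1 := by
      rw [min_eq_left hp.2.2, max_eq_right (hp.1.trans hp.2.1)]
    simp [cl, h1, hp.1, hp.2.1]
  have hcl_cont : Continuous cl := by fun_prop
  let q' : ℝ → ℝ → ℝ := fun r σ => q (cl (r, σ))
  have hq' : Continuous (Function.uncurry q') :=
    (hq.mono hTW).comp_continuous hcl_cont hcl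
  have hq'r : ∀ r, Continuous (q' r) := fun r => hq'.comp (by fun_prop : Continuous (Prod.mk r))
  obtain ⟨C, hC⟩ := (isCompact_triangle δ ρ).exists_bound_of_continuousOn (hq.mono hTW)
  have hΔ : ∀ r R, (r, R) ∈ T →
      a.sqrtΔ r R = (∫ σ in (0 : ℝ)..r, q' r σ) - (∫ σ in (0 : ℝ)..R, q' r σ)
        + a.H r r / a.Y r r := by
    intro r R hrR
    rw [intervalIntegral.integral_interval_sub_left ((hq'r r).intervalIntegrable _ _)
      ((hq'r r).intervalIntegrable _ _), sqrtΔ]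
    congr 1
    refine intervalIntegral.integral_congr fun σ hσ => ?_
    rw [uIcc_of_le hrR.2.1] at hσ
    simp only [q']
    rw [hcl_id (r, σ) ⟨hrR.1.trans hσ.1, hσ.2, hrR.2.2⟩]
  constructor
  · have hcont : ContinuousOn (fun p : ℝ × ℝ =>
        (∫ σ in (0 : ℝ)..p.1, q' p.1 σ) - (∫ σ in (0 : ℝ)..p.2, q' p.1 σ)
          + a.H p.1 p.1 / a.Y p.1 p.1) T := by
      have hprim : ∀ s : ℝ × ℝ → ℝ, Continuous s →
          Continuous fun p : ℝ × ℝ => ∫ σ in (0 : ℝ)..s p, q' p.1 σ := fun s hs =>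
        continuous_parametric_intervalIntegral_of_continuous
          (f := fun p : ℝ × ℝ => q' p.1)
          (hq'.comp (by fun_prop : Continuous fun z : (ℝ × ℝ) × ℝ => (z.1.1, z.2))) hs
      have hdiag : MapsTo (fun p : ℝ × ℝ => (p.1, p.1)) T W := fun p hp =>
        hTW ⟨hp.1.trans hp.2.1, le_rfl, hp.2.2⟩
      have hdc : ContinuousOn (fun p : ℝ × ℝ => (p.1, p.1)) T := by fun_prop
      exact ((hprim _ continuous_fst).sub (hprim _ continuous_snd)).continuousOn.add
        ((hH.continuousOn.comp hdc hdiag).div (hY.continuousOn.comp hdc hdiag)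
          fun p hp => (hYpos _ (hdiag hp)).ne')
    exact hcont.congr fun p hp => hΔ p.1 p.2 hp
  · refine ⟨C, fun r hr R hR R' hR' => ?_⟩
    rw [hΔ r R ⟨hR.1, hR.2, hr⟩, hΔ r R' ⟨hR'.1, hR'.2, hr⟩]
    have : ∀ x y z w : ℝ, x - y + z - (x - w + z) = w - y := fun x y z w => by ring
    rw [this, intervalIntegral.integral_interval_sub_left ((hq'r r).intervalIntegrable _ _)
      ((hq'r r).intervalIntegrable _ _), abs_sub_comm R R', ← Real.norm_eq_abs]
    exact norm_integral_le_of_norm_le_const fun σ _ => hC _ (hcl _)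

/-- On `δ ≤ R ≤ r ≤ ρ` the radial slope is continuous, and Lipschitz in `R` uniformly in `r`. -/
theorem radialSlope_regular {δ ρ : ℝ} (hδ : 0 < δ) (hρ : ρ ≤ a.r₀) :
    ContinuousOn (Function.uncurry a.radialSlope) {p | δ ≤ p.2 ∧ p.2 ≤ p.1 ∧ p.1 ≤ ρ} ∧
    ∃ K : NNReal, ∀ r ≤ ρ, LipschitzOnWith K (a.radialSlope r) (Icc δ r) := by
  obtain ⟨W, -, hW, -, hY, hu, -⟩ := a.exists_isOpen_contDiffOn
  let T : Set (ℝ × ℝ) := {p | δ ≤ p.2 ∧ p.2 ≤ p.1 ∧ p.1 ≤ ρ}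
  have hTW : T ⊆ W := fun p hp => hW p.1 p.2 (hδ.trans_le hp.1) hp.2.1 (hp.2.2.trans hρ)
  let v : ℝ × ℝ → ℝ := fun p => a.u p.1 p.2 * (a.Y p.1 p.2 - a.u p.1 p.2)
  have hv : ContDiffOn ℝ (⊤ : ℕ∞) v T := (hu.mul (hY.sub hu)).mono hTW
  obtain ⟨L, hL⟩ := hv.exists_lipschitzOnWith (by simp) (convex_triangle δ ρ) (isCompact_triangle δ ρ)
  obtain ⟨hΔc, C, hC⟩ := a.sqrtΔ_regular hδ hρ
  obtain ⟨A, hA⟩ := (isCompact_triangle δ ρ).exists_bound_of_continuousOn hv.continuousOn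
  obtain ⟨B, hB⟩ := (isCompact_triangle δ ρ).exists_bound_of_continuousOn hΔc
  have hslope : ∀ r R, a.radialSlope r R = v (r, R) * a.sqrtΔ r R := fun r R => by
    simp only [radialSlope, v]; ring
  refine ⟨(hv.continuousOn.mul hΔc).congr fun p _ => hslope p.1 p.2,
    (A * C + B * L).toNNReal, fun r hr => LipschitzOnWith.of_dist_le_mul fun R hR R' hR' => ?_⟩
  have hp : (r, R) ∈ T := ⟨hR.1, hR.2, hr⟩
  have hp' : (r, R') ∈ T := ⟨hR'.1, hR'.2, hr⟩
  have h1 : |v (r, R)| ≤ A := hA _ hp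
  have h2 : |a.sqrtΔ r R'| ≤ B := hB _ hp'
  have h3 : |v (r, R) - v (r, R')| ≤ L * |R - R'| := by
    simpa [Real.dist_eq, Prod.dist_eq] using hL.dist_le_mul _ hp _ hp'
  have h4 := hC r hr R hR R' hR'
  rw [Real.dist_eq, Real.dist_eq, hslope, hslope]
  calc |v (r, R) * a.sqrtΔ r R - v (r, R') * a.sqrtΔ r R'|
      = |v (r, R) * (a.sqrtΔ r R - a.sqrtΔ r R')
          + (v (r, R) - v (r, R')) * a.sqrtΔ r R'| := by congr 1; ring
    _ ≤ |v (r, R)| * |a.sqrtΔ r R - a.sqrtΔ r R'|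
          + |v (r, R) - v (r, R')| * |a.sqrtΔ r R'| := by
        rw [← abs_mul, ← abs_mul]; exact abs_add_le _ _
    _ ≤ A * (C * |R - R'|) + (L * |R - R'|) * B := by gcongr; exact (abs_nonneg _).trans h1
    _ = (A * C + B * L) * |R - R'| := by ring
    _ ≤ (A * C + B * L).toNNReal * |R - R'| := by gcongr; exact le_coe_toNNReal _

end ARSData

namespace ARSData

variable {a : ARSData}

theorem differentiableAt_uncurry_Ψ {r R : ℝ} (hr : r ∈ Icc 0 a.r₀) (hR : R ∈ Icc 0 a.r₀) :
    DifferentiableAt ℝ (Function.uncurry a.Ψ) (r, R) := by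
  obtain ⟨U, hUo, hU, hΨ, -⟩ := a.smooth
  exact (hΨ.contDiffAt (hUo.mem_nhds (hU ⟨hr, hR⟩))).differentiableAt (by simp)

theorem hasDerivAt_Ψ_left {r R : ℝ} (hr : r ∈ Icc 0 a.r₀) (hR : R ∈ Icc 0 a.r₀) :
    HasDerivAt (fun s => a.Ψ s R) (fderiv ℝ (Function.uncurry a.Ψ) (r, R) (1, 0)) r :=
  (differentiableAt_uncurry_Ψ hr hR).hasFDerivAt.comp_hasDerivAt (f := fun s => (s, R)) r
    ((hasDerivAt_id r).prodMk (hasDerivAt_const r R))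

theorem hasDerivAt_Ψ_right {r R : ℝ} (hr : r ∈ Icc 0 a.r₀) (hR : R ∈ Icc 0 a.r₀) :
    HasDerivAt (fun s => a.Ψ r s) (fderiv ℝ (Function.uncurry a.Ψ) (r, R) (0, 1)) R :=
  (differentiableAt_uncurry_Ψ hr hR).hasFDerivAt.comp_hasDerivAt R
    ((hasDerivAt_const R r).prodMk (hasDerivAt_id R))

/-- The derivative of the mass along a curve. -/
theorem hasDerivWithinAt_Ψ_comp {y : ℝ → ℝ} {y' r : ℝ} {s : Set ℝ} (hr : r ∈ Icc 0 a.r₀)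
    (hy : y r ∈ Icc 0 a.r₀) (hd : HasDerivWithinAt y y' s r) :
    HasDerivWithinAt (fun t => a.Ψ t (y t))
      (deriv (fun s => a.Ψ s (y r)) r + y' * deriv (fun s => a.Ψ r s) (y r)) s r := by
  have h := (differentiableAt_uncurry_Ψ hr hy).hasFDerivAt.comp_hasDerivWithinAt
    (f := fun t => (t, y t)) r ((hasDerivWithinAt_id r s).prodMk hd)
  have hadd : ((1 : ℝ), y') = (1, 0) + y' • (0, 1) := by simp
  rw [hadd, map_add, map_smul, smul_eq_mul, ← (hasDerivAt_Ψ_left hr hy).deriv,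
    ← (hasDerivAt_Ψ_right hr hy).deriv] at h
  exact h

theorem Ψ_monotoneOn_left {R : ℝ} (hR : R ∈ Icc 0 a.r₀) :
    MonotoneOn (fun r => a.Ψ r R) (Icc 0 a.r₀) :=
  monotoneOn_of_deriv_nonneg (convex_Icc _ _)
    (fun _ hr => (hasDerivAt_Ψ_left hr hR).continuousAt.continuousWithinAt)
    (fun _ hr => (hasDerivAt_Ψ_left (interior_subset hr) hR).differentiableAt.differentiableWithinAt)
    fun r hr => a.Ψr_nonneg r (interior_subset hr) R hR

variable (a) in
theorem exists_deriv_Ψ_right_lt : ∃ ρ ∈ Ioc 0 a.r₀, ∀ r ∈ Icc 0 ρ, ∀ R ∈ Icc 0 ρ,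
    deriv (fun s => a.Ψ r s) R < 1 / 2 := by
  obtain ⟨U, hUo, hU, hΨ, -⟩ := a.smooth
  have h00 : (0 : ℝ) ∈ Icc 0 a.r₀ := left_mem_Icc.2 a.r₀_pos.le
  have hcont : ContinuousAt (fun p => fderiv ℝ (Function.uncurry a.Ψ) p (0, 1)) (0, 0) :=
    ((hΨ.continuousOn_fderiv_of_isOpen hUo (by simp)).continuousAt
      (hUo.mem_nhds (hU ⟨h00, h00⟩))).clm_apply continuousAt_const
  have hzero : fderiv ℝ (Function.uncurry a.Ψ) (0, 0) (0, 1) < 1 / 2 := by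
    rw [← (hasDerivAt_Ψ_right h00 h00).deriv, a.ΨR_origin]
    norm_num
  obtain ⟨ε, hε, hball⟩ := Metric.eventually_nhds_iff.1 (hcont.eventually_lt_const hzero)
  refine ⟨min (ε / 2) a.r₀, ⟨lt_min (half_pos hε) a.r₀_pos, min_le_right _ _⟩,
    fun r hr R hR => ?_⟩
  have hsub : Icc 0 (min (ε / 2) a.r₀) ⊆ Icc 0 a.r₀ := Icc_subset_Icc_right (min_le_right _ _)
  rw [(hasDerivAt_Ψ_right (hsub hr) (hsub hR)).deriv]
  have hlt : ∀ x ∈ Icc 0 (min (ε / 2) a.r₀), |x| < ε := fun x hx => by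
    rw [abs_of_nonneg hx.1]
    exact (hx.2.trans (min_le_left _ _)).trans_lt (half_lt_self hε)
  refine hball ?_
  rw [Prod.dist_eq, Real.dist_eq, Real.dist_eq, sub_zero, sub_zero]
  exact max_lt (hlt r hr) (hlt R hR)

/-- Where `∂Ψ/∂R` is small the function `R - 2Ψ` is strictly increasing in `R`. -/
theorem strictMonoOn_sub_two_mul_Ψ {ρ r : ℝ} (hρ : ρ ≤ a.r₀) (hr : r ∈ Icc 0 ρ)
    (hΨ : ∀ R ∈ Icc 0 ρ, deriv (fun s => a.Ψ r s) R < 1 / 2) :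
    StrictMonoOn (fun R => R - 2 * a.Ψ r R) (Icc 0 ρ) := by
  have hd : ∀ R ∈ Icc 0 ρ, HasDerivAt (fun R => R - 2 * a.Ψ r R)
      (1 - 2 * fderiv ℝ (Function.uncurry a.Ψ) (r, R) (0, 1)) R := fun R hR =>
    (hasDerivAt_id R).sub ((hasDerivAt_Ψ_right (Icc_subset_Icc_right hρ hr)
      (Icc_subset_Icc_right hρ hR)).const_mul 2)
  refine strictMonoOn_of_deriv_pos (convex_Icc _ _)
    (fun R hR => (hd R hR).continuousAt.continuousWithinAt) fun R hR => ?_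
  have hR := interior_subset hR
  have := hΨ R hR
  rw [(hasDerivAt_Ψ_right (Icc_subset_Icc_right hρ hr) (Icc_subset_Icc_right hρ hR)).deriv] at this
  rw [(hd R hR).deriv]
  linarith

variable (a) in
theorem eventually_G_zero_pos : ∀ᶠ r in 𝓝[>] (0 : ℝ), 0 < a.G r 0 := by
  have htend : Tendsto (fun r : ℝ => (r, (0 : ℝ))) (𝓝[>] 0)
      (𝓝[Icc 0 a.r₀ ×ˢ Icc 0 a.r₀] (0, 0)) := by
    refine tendsto_nhdsWithin_iff.2 ⟨?_, ?_⟩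
    · exact ((Continuous.prodMk_left (0 : ℝ)).tendsto 0).mono_left nhdsWithin_le_nhds
    · filter_upwards [Ioc_mem_nhdsGT a.r₀_pos] with r hr
      exact ⟨Ioc_subset_Icc_self hr, left_mem_Icc.2 a.r₀_pos.le⟩
  filter_upwards [htend.eventually (a.taylor.def (half_pos a.α_pos)), self_mem_nhdsWithin]
    with r hr hpos
  have hr3 : 0 < r ^ 3 := pow_pos hpos 3
  simp only [Real.norm_eq_abs, add_zero, abs_of_pos hr3] at hr
  have := (abs_le.1 hr).1
  have hh := mul_pos a.α_pos hr3
  rw [G]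
  nlinarith

theorem H_nonneg (r R : ℝ) : 0 ≤ a.H r R := Real.sqrt_nonneg _

theorem continuousOn_H {r : ℝ} (hr : r ∈ Icc 0 a.r₀) (hG : 0 < a.G r 0) :
    ContinuousOn (a.H r) (Icc 0 r) := by
  have hGc : ContinuousOn (a.G r) (Icc 0 r) :=
    continuousOn_uncurry_G.comp (by fun_prop : ContinuousOn (fun R => (r, R)) (Icc 0 r))
      fun R hR => ⟨hr, hR.1, hR.2.trans hr.2⟩
  refine (continuousOn_id.div hGc fun R hR => ?_).sqrt
  rcases hR.1.eq_or_lt with rfl | hpos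
  · exact hG.ne'
  · exact (a.G_pos r R hpos hR.2 hr.2).ne'

/-- The slope of a null geodesic with nonzero angular momentum is smaller than the radial one. -/
theorem nonradial_slope_lt_radialSlope {L r R : ℝ} (hL : 0 < L) (hR : 0 < R) (hRr : R ≤ r)
    (hr : r ≤ a.r₀) :
    a.u r R * a.Y r R * a.sqrtΔ r R -
      a.u r R ^ 2 * Real.sqrt (a.sqrtΔ r R ^ 2 + L ^ 2 / (a.u r R ^ 2 * R ^ 2))
      < a.radialSlope r R := by
  have hu := u_pos hR hRr hr
  have hlt : a.sqrtΔ r R < Real.sqrt (a.sqrtΔ r R ^ 2 + L ^ 2 / (a.u r R ^ 2 * R ^ 2)) :=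
    Real.lt_sqrt_of_sq_lt (by linarith [show 0 < L ^ 2 / (a.u r R ^ 2 * R ^ 2) by positivity])
  have := mul_lt_mul_of_pos_left hlt (pow_pos hu 2)
  rw [radialSlope]
  linarith

/-- The function `R - 2Ψ` stays positive along backward radial null geodesics. -/
theorem sub_two_mul_Ψ_pos_of_radial {ε ρ : ℝ} (hε : 0 < ε) (hερ : ε ≤ ρ) (hρ : ρ ≤ a.r₀)
    (hΔ : ∀ r ∈ Icc ε ρ, ∀ R ∈ Icc (0 : ℝ) r, 0 < a.sqrtΔ r R) {y : ℝ → ℝ}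
    (hd : ∀ r ∈ Icc ε ρ, HasDerivWithinAt y (a.radialSlope r (y r)) (Icc ε ρ) r)
    (hy : ∀ r ∈ Icc ε ρ, 0 < y r ∧ y r ≤ r) (hend : 0 < y ρ - 2 * a.Ψ ρ (y ρ)) :
    0 < y ε - 2 * a.Ψ ε (y ε) := by
  have hycont : ContinuousOn y (Icc ε ρ) := fun r hr => (hd r hr).continuousWithinAt
  have hIcc : ∀ r ∈ Icc ε ρ, r ∈ Icc 0 a.r₀ ∧ y r ∈ Icc 0 a.r₀ := fun r hr =>
    ⟨⟨hε.le.trans hr.1, hr.2.trans hρ⟩, (hy r hr).1.le, (hy r hr).2.trans (hr.2.trans hρ)⟩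
  obtain ⟨r₀, hr₀, hmin⟩ := isCompact_Icc.exists_isMinOn (nonempty_Icc.2 hερ) hycont
  have hΔcont : ContinuousOn (fun r => a.sqrtΔ r (y r)) (Icc ε ρ) :=
    (sqrtΔ_regular (hy r₀ hr₀).1 hρ).1.comp (continuousOn_id.prodMk hycont)
      fun r hr => ⟨hmin hr, (hy r hr).2, hr.2⟩
  obtain ⟨M, hM⟩ := isCompact_Icc.exists_bound_of_continuousOn
    (hΔcont.div hycont fun r hr => (hy r hr).1.ne')
  let D : ℝ → ℝ := fun t => y t - 2 * a.Ψ t (y t)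
  let B : ℝ → ℝ := fun t => D ρ * Real.exp ((M + 1) * (t - ρ))
  have hB : ∀ t, HasDerivAt B ((M + 1) * B t) t := fun t => by
    have h := ((((hasDerivAt_id t).sub_const ρ).const_mul (M + 1)).exp).const_mul (D ρ)
    refine h.congr_deriv ?_
    simp only [B, id, mul_one]
    ring
  have hBpos : ∀ t, 0 < B t := fun t => mul_pos hend (Real.exp_pos _)
  refine (hBpos ε).trans_le ?_
  refine image_le_of_deriv_left_lt_deriv_boundary (B := D) (fun t _ => (hB t).hasDerivWithinAt)
    (fun t ht => (hd t ht).sub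
      ((hasDerivWithinAt_Ψ_comp (hIcc t ht).1 (hIcc t ht).2 (hd t ht)).const_mul 2))
    (by simp [B]) (fun t ht hBD => ?_) ε (left_mem_Icc.2 hερ)
  obtain ⟨hy0, hyt⟩ := hy t ht
  have htr : t ≤ a.r₀ := (hIcc t ht).1.2
  have hDt : 0 < D t := hBD ▸ hBpos t
  have hu := u_pos hy0 hyt htr
  have hY := a.Y_pos t (hIcc t ht).1 (y t) (hIcc t ht).2
  have hΔt := hΔ t ht (y t) ⟨hy0.le, hyt⟩
  have hfac := mul_sub_u_mul_add_u hy0 hyt htr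
  have hMt : a.sqrtΔ t (y t) / y t ≤ M := (le_abs_self _).trans (hM t ht)
  have hYu : a.Y t (y t) - a.u t (y t) = D t / (y t * (a.Y t (y t) + a.u t (y t))) := by
    rw [eq_div_iff (by positivity), mul_comm (y t), ← mul_assoc, hfac]
  have hslope : a.radialSlope t (y t) = a.sqrtΔ t (y t) / y t * D t *
      (a.u t (y t) / (a.Y t (y t) + a.u t (y t))) := by
    rw [radialSlope, hYu]
    field_simp
  have hslope0 : 0 ≤ a.radialSlope t (y t) := by rw [hslope]; positivity
  have hslope1 : a.radialSlope t (y t) ≤ M * D t := by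
    rw [hslope]
    calc _ ≤ a.sqrtΔ t (y t) / y t * D t * 1 := by
          gcongr
          exact (div_le_one (by positivity)).2 (by linarith)
      _ ≤ M * D t := by rw [mul_one]; gcongr
  have hΨr := a.Ψr_nonneg t (hIcc t ht).1 (y t) (hIcc t ht).2
  have hΨR := mul_nonneg hslope0 (a.ΨR_nonneg t (hIcc t ht).1 (y t) (hIcc t ht).2)
  rw [hBD]
  change _ < (M + 1) * D t
  linarith

end ARSData

namespace CollapsingARS

variable (c : CollapsingARS)

/-- Below a strict upper barrier for the radial null geodesic equation which lies above the
apparent horizon there is a radial null geodesic, also above the apparent horizon. -/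
theorem exists_radial_of_barrier {ρ : ℝ} (hρ : ρ ∈ Ioc 0 c.r₀)
    (hΨ : ∀ r ∈ Icc 0 ρ, ∀ R ∈ Icc 0 ρ, deriv (fun s => c.Ψ r s) R < 1 / 2) {S S' : ℝ → ℝ}
    (hS : ∀ r ∈ Ioc 0 ρ, HasDerivAt S (S' r) r)
    (hS' : ∀ r ∈ Ioc 0 ρ, S' r < c.radialSlope r (S r))
    (hSr : ∀ r ∈ Ioc 0 ρ, c.Rh r < S r ∧ S r < r) :
    ∃ y : ℝ → ℝ, ∀ r ∈ Ioc 0 ρ,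
      HasDerivWithinAt y (c.radialSlope r (y r)) (Ioc 0 ρ) r ∧ c.Rh r < y r ∧ y r ≤ S r := by
  have hsub : ∀ r ∈ Ioc 0 ρ, r ∈ Ioc 0 c.r₀ := fun r hr => ⟨hr.1, hr.2.trans hρ.2⟩
  have hmono : ∀ r ∈ Ioc 0 ρ, StrictMonoOn (fun R => R - 2 * c.Ψ r R) (Icc 0 ρ) := fun r hr =>
    ARSData.strictMonoOn_sub_two_mul_Ψ hρ.2 (Ioc_subset_Icc_self hr) (hΨ r (Ioc_subset_Icc_self hr))
  have hRh : ∀ r ∈ Ioc 0 ρ, c.Rh r ∈ Icc 0 ρ := fun r hr =>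
    ⟨(c.Rh_pos r (hsub r hr)).le, (c.Rh_lt r (hsub r hr)).le.trans hr.2⟩
  have hS_Icc : ∀ r ∈ Ioc 0 ρ, S r ∈ Icc 0 ρ := fun r hr =>
    ⟨(hRh r hr).1.trans (hSr r hr).1.le, (hSr r hr).2.le.trans hr.2⟩
  have hD_Rh : ∀ r ∈ Ioc 0 ρ, c.Rh r - 2 * c.Ψ r (c.Rh r) = 0 := fun r hr =>
    sub_eq_zero.2 (c.Rh_eq r (hsub r hr))
  have hD_pos : ∀ r ∈ Ioc 0 ρ, ∀ R ∈ Icc 0 ρ, c.Rh r < R ↔ 0 < R - 2 * c.Ψ r R :=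
    fun r hr R hR => by
      rw [← hD_Rh r hr]
      exact ((hmono r hr).lt_iff_lt (hRh r hr) hR).symm
  obtain ⟨y, hyρ, hy⟩ := exists_solution_below_barrier hρ.1
    (fun δ hδ => (ARSData.radialSlope_regular hδ hρ.2).1)
    (fun δ hδ => (ARSData.radialSlope_regular hδ hρ.2).2) hS hS' (fun r hr => (hSr r hr).2) <| by
      intro ε hε
      have hpos := c.Rh_pos ε (hsub ε hε)
      have hδ : c.Rh ε / 2 ∈ Icc 0 ρ :=
        ⟨(half_pos hpos).le, (half_le_self hpos.le).trans (hRh ε hε).2⟩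
      refine ⟨c.Rh ε / 2, half_pos hpos, fun r hr => ?_⟩
      have hr' : r ∈ Ioc 0 ρ := ⟨hε.1.trans_le hr.1, hr.2⟩
      have hδr : c.Rh ε / 2 ≤ r :=
        (half_le_self hpos.le).trans ((c.Rh_lt ε (hsub ε hε)).le.trans hr.1)
      have hDε : c.Rh ε / 2 - 2 * c.Ψ ε (c.Rh ε / 2) < 0 := by
        rw [← hD_Rh ε hε]
        exact hmono ε hε hδ (hRh ε hε) (half_lt_self hpos)
      have hΨmono : c.Ψ ε (c.Rh ε / 2) ≤ c.Ψ r (c.Rh ε / 2) :=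
        ARSData.Ψ_monotoneOn_left (Icc_subset_Icc_right hρ.2 hδ)
          (Ioc_subset_Icc_self (hsub ε hε)) (Ioc_subset_Icc_self (hsub r hr')) hr.1
      have hDr : c.Rh ε / 2 - 2 * c.Ψ r (c.Rh ε / 2) < 0 := by linarith
      constructor
      · refine ((hmono r hr').lt_iff_lt hδ (hS_Icc r hr')).1 ?_
        exact hDr.trans ((hD_pos r hr' _ (hS_Icc r hr')).1 (hSr r hr').1)
      · have hu := ARSData.u_pos (half_pos hpos) hδr (hsub r hr').2
        have hY := c.Y_pos r (Ioc_subset_Icc_self (hsub r hr')) _ (Icc_subset_Icc_right hρ.2 hδ)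
        have hfac := ARSData.mul_sub_u_mul_add_u (half_pos hpos) hδr (hsub r hr').2
        refine mul_neg_of_pos_of_neg
          (mul_pos hu (c.sqrtΔ_pos r (hsub r hr') _ ⟨hδ.1, hδr⟩)) ?_
        rw [← hfac, mul_assoc] at hDr
        exact neg_of_mul_neg_left hDr (mul_pos (add_pos hY hu) (half_pos hpos)).le
  refine ⟨y, fun r hr => ⟨(hy r hr).1, ?_, (hy r hr).2.2⟩⟩
  have hmem : ∀ t ∈ Icc r ρ, t ∈ Ioc 0 ρ := fun t ht => ⟨hr.1.trans_le ht.1, ht.2⟩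
  have hρρ : ρ ∈ Ioc 0 ρ := right_mem_Ioc.2 hρ.1
  refine (hD_pos r hr (y r) ⟨(hy r hr).2.1.le, (hy r hr).2.2.trans (hS_Icc r hr).2⟩).2 ?_
  refine ARSData.sub_two_mul_Ψ_pos_of_radial hr.1 hr.2 hρ.2
    (fun t ht => c.sqrtΔ_pos t (hsub t (hmem t ht)))
    (fun t ht => (hy t (hmem t ht)).1.mono hmem)
    (fun t ht => ⟨(hy t (hmem t ht)).2.1,
      (hy t (hmem t ht)).2.2.trans (hSr t (hmem t ht)).2.le⟩) ?_
  rw [hyρ]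
  exact (hD_pos ρ hρρ _ (hS_Icc ρ hρρ)).1 (hSr ρ hρρ).1

end CollapsingARS

/-- **Proposition (radially censored implies censored).** In a collapsing ARS model,
if the central singularity is covered (no radial null geodesic escapes), then for every
angular momentum `L > 0` no non-radial null geodesic escapes either: there is no solution
`R̃` of `dR/dr = u Y √Δ − u² √(Δ + L²/(u² R²))` escaping from the apparent horizon back
to the central singularity. Here `Δ = (√Δ)²`. -/
theorem censored_of_radially_censored (c : CollapsingARS)
    (hcov : ¬ c.LocallyNaked) :
    ∀ L : ℝ, 0 < L →
      ¬ ∃ r₁ ∈ Ioc (0:ℝ) c.r₀, ∃ Rt : ℝ → ℝ,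
        (∀ r ∈ Ioc (0:ℝ) r₁, HasDerivAt Rt
          (c.u r (Rt r) * c.Y r (Rt r) * c.sqrtΔ r (Rt r) -
            (c.u r (Rt r)) ^ 2 *
              Real.sqrt ((c.sqrtΔ r (Rt r)) ^ 2 +
                L ^ 2 / ((c.u r (Rt r)) ^ 2 * (Rt r) ^ 2))) r) ∧
        (∀ r ∈ Ioc (0:ℝ) r₁, c.Rh r < Rt r ∧ Rt r < r) ∧
        Tendsto Rt (𝓝[>] 0) (𝓝 0) ∧
        Tendsto (fun r => ∫ σ in (0:ℝ)..(Rt r), c.H r σ) (𝓝[>] 0) (𝓝 0) := by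
  rintro L hL ⟨r₁, hr₁, S, hS, hSr, hS0, hSH⟩
  obtain ⟨ρ₀, hρ₀, hΨ⟩ := c.exists_deriv_Ψ_right_lt
  set ρ := min r₁ ρ₀
  have hρ : 0 < ρ := lt_min hr₁.1 hρ₀.1
  have hρr₁ : Ioc 0 ρ ⊆ Ioc 0 r₁ := Ioc_subset_Ioc_right (min_le_left _ _)
  have hIcc : Icc 0 ρ ⊆ Icc 0 ρ₀ := Icc_subset_Icc_right (min_le_right _ _)
  have hρr₀ : ρ ≤ c.r₀ := (min_le_left _ _).trans hr₁.2
  have hSpos : ∀ r ∈ Ioc 0 ρ, 0 < S r := fun r hr =>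
    (c.Rh_pos r ⟨hr.1, hr.2.trans hρr₀⟩).trans (hSr r (hρr₁ hr)).1
  obtain ⟨y, hy⟩ := c.exists_radial_of_barrier ⟨hρ, hρr₀⟩
    (fun r hr R hR => hΨ r (hIcc hr) R (hIcc hR)) (fun r hr => hS r (hρr₁ hr))
    (fun r hr => ARSData.nonradial_slope_lt_radialSlope hL (hSpos r hr) (hSr r (hρr₁ hr)).2.le
      (hr.2.trans hρr₀)) (fun r hr => hSr r (hρr₁ hr))
  have hypos : ∀ r ∈ Ioc 0 ρ, 0 < y r := fun r hr =>
    (c.Rh_pos r ⟨hr.1, hr.2.trans hρr₀⟩).trans (hy r hr).2.1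
  have hhalf : Ioc 0 (ρ / 2) ⊆ Ioc 0 ρ := Ioc_subset_Ioc_right (half_le_self hρ.le)
  have hev : ∀ᶠ r in 𝓝[>] (0 : ℝ), r ∈ Ioc 0 ρ := Ioc_mem_nhdsGT hρ
  refine hcov ⟨ρ / 2, ⟨half_pos hρ, (half_le_self hρ.le).trans hρr₀⟩, y, fun r hr => ?_,
    fun r hr => ⟨(hy r (hhalf hr)).2.1,
      (hy r (hhalf hr)).2.2.trans_lt (hSr r (hρr₁ (hhalf hr))).2⟩, ?_, ?_⟩
  · exact (hy r (hhalf hr)).1.hasDerivAt (Ioc_mem_nhds hr.1 (hr.2.trans_lt (half_lt_self hρ)))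
  · refine tendsto_of_tendsto_of_tendsto_of_le_of_le' tendsto_const_nhds hS0 ?_ ?_
    · filter_upwards [hev] with r hr using (hypos r hr).le
    · filter_upwards [hev] with r hr using (hy r hr).2.2
  · refine tendsto_of_tendsto_of_tendsto_of_le_of_le' tendsto_const_nhds hSH ?_ ?_
    · filter_upwards [hev] with r hr
      exact integral_nonneg (hypos r hr).le fun σ _ => ARSData.H_nonneg r σ
    · filter_upwards [hev, c.eventually_G_zero_pos] with r hr hG
      refine integral_mono_interval le_rfl (hypos r hr).le (hy r hr).2.2
        (Eventually.of_forall fun σ => ARSData.H_nonneg r σ) ?_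
      refine ContinuousOn.intervalIntegrable ?_
      rw [uIcc_of_le (hSpos r hr).le]
      exact (ARSData.continuousOn_H ⟨hr.1.le, hr.2.trans hρr₀⟩ hG).mono
        (Icc_subset_Icc_right (hSr r (hρr₁ hr)).2.le)
end
end
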